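/- Let n ≥ 1, θ ∈ ℝ, and let H₀ be a closed subspace of L²(ℝ^{2n+1}, λ; ℂ), not equal to {0}, such that Π^θ(φ)H₀ ⊆ H₀ for every compactly supported contactomorphism φ of (ℝ^{2n+1}, ker α₀). Then for every nonempty open set U ⊆ ℝ^{2n+1} there exists f ∈ H₀ which is not almost everywhere zero and vanishes almost everywhere outside U. -/

import Mathlib

open MeasureTheory

/-- `ℝ²ⁿ⁺¹ = ℝⁿ × ℝⁿ × ℝ`, identified with the Heisenberg group `H_n`. -/
abbrev H (n : ℕ) := EuclideanSpace ℝ (Fin n) × EuclideanSpace ℝ (Fin n) × ℝ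

/-- The Heisenberg group product `(x,y,z)·(x',y',z') = (x+x', y+y', z+z'+⟨x,y'⟩)`. -/
noncomputable def hmul {n : ℕ} (p q : H n) : H n :=
  (p.1 + q.1, p.2.1 + q.2.1, p.2.2 + q.2.2 + ∑ i, p.1 i * q.2.1 i)

/-- The standard contact form `α₀ = dz - ∑ yⁱ dxⁱ`: at the point `p = (x,y,z)`,
applied to a tangent vector `ζ = (u,v,w)` it gives `w - ⟨y,u⟩`. -/
noncomputable def alpha0 {n : ℕ} (p : H n) (ζ : H n) : ℝ :=
  ζ.2.2 - ∑ i, p.2.1 i * ζ.1 i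

/-- A compactly supported contactomorphism of `(ℝ²ⁿ⁺¹, ker α₀)`: a `C^∞`
diffeomorphism whose support has compact closure and whose derivative preserves
the contact distribution `ker α₀`. -/
structure CSContactomorphism (n : ℕ) where
  toFun : H n → H n
  invFun : H n → H n
  left_inv : Function.LeftInverse invFun toFun
  right_inv : Function.RightInverse invFun toFun
  smooth : ContDiff ℝ (⊤ : ℕ∞) toFun
  smooth_inv : ContDiff ℝ (⊤ : ℕ∞) invFun
  compactSupp : IsCompact (closure {p | toFun p ≠ p})
  contact : ∀ p ζ, alpha0 p ζ = 0 → alpha0 (toFun p) (fderiv ℝ toFun p ζ) = 0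

/-- The Radon–Nikodym derivative `d(γ_*λ)/dλ` of the pushforward of Lebesgue
measure under `γ`, computed as `J(p) = |det D(γ⁻¹)(p)|`. -/
noncomputable def jac {n : ℕ} (γ : CSContactomorphism n) (p : H n) : ℝ :=
  |(fderiv ℝ γ.invFun p).det|

/-- The representation `Π^θ(γ)f(p) = f(γ⁻¹(p)) · J(p)^{1/2} · exp(iθ log J(p))`. -/
noncomputable def PiTheta {n : ℕ} (θ : ℝ) (γ : CSContactomorphism n)
    (f : H n → ℂ) : H n → ℂ :=
  fun p => f (γ.invFun p) * (Real.sqrt (jac γ p) : ℂ) *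
    Complex.exp (Complex.I * θ * (Real.log (jac γ p) : ℂ))

section

open scoped ContDiff NNReal ENNReal Topology

/-- A smooth perturbation of the identity whose derivative is bounded by `1/2` is a
diffeomorphism. -/
lemma exists_smooth_inverse {E : Type*} [NormedAddCommGroup E] [NormedSpace ℝ E] [CompleteSpace E]
    {f : E → E} (hf : ContDiff ℝ ∞ f)
    (hf' : ∀ q, ‖fderiv ℝ f q - ContinuousLinearMap.id ℝ E‖ ≤ 1 / 2) :
    ∃ g : E → E, Function.LeftInverse g f ∧ Function.RightInverse g f ∧ ContDiff ℝ ∞ g := by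
  have hd : Differentiable ℝ f := hf.differentiable (by simp)
  have happ : ApproximatesLinearOn f (ContinuousLinearEquiv.refl ℝ E : E →L[ℝ] E) Set.univ
      (1 / 2 : ℝ≥0) := by
    intro x _ y _
    have h := Convex.norm_image_sub_le_of_norm_hasFDerivWithin_le' (f := f) (s := Set.univ)
      (C := 1 / 2) (φ := ContinuousLinearMap.id ℝ E)
      (fun q _ => (hd q).hasFDerivAt.hasFDerivWithinAt) (fun q _ => hf' q) convex_univ
      (Set.mem_univ y) (Set.mem_univ x)
    simpa using h
  have hc : Subsingleton E ∨ (1 / 2 : ℝ≥0) <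
      ‖((ContinuousLinearEquiv.refl ℝ E).symm : E →L[ℝ] E)‖₊⁻¹ := by
    rcases subsingleton_or_nontrivial E with h | h
    · exact Or.inl h
    · right
      have h1 : ‖((ContinuousLinearEquiv.refl ℝ E).symm : E →L[ℝ] E)‖₊ = 1 :=
        ContinuousLinearMap.nnnorm_id
      rw [h1, inv_one]
      exact NNReal.half_lt_self one_ne_zero
  let e := happ.toHomeomorph f hc
  have hunit : ∀ q, ∃ L : E ≃L[ℝ] E, (L : E →L[ℝ] E) = fderiv ℝ f q := by
    intro q
    have hlt : ‖ContinuousLinearMap.id ℝ E - fderiv ℝ f q‖ < 1 := by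
      rw [norm_sub_rev]
      exact (hf' q).trans_lt (by norm_num)
    refine ⟨ContinuousLinearEquiv.unitsEquiv ℝ E (Units.oneSub _ hlt), ?_⟩
    ext v
    change (1 - (ContinuousLinearMap.id ℝ E - fderiv ℝ f q)) v = fderiv ℝ f q v
    simp
  choose L hL using hunit
  have hsymm : ContDiff ℝ ∞ e.symm := by
    refine e.contDiff_symm (f₀' := L) (fun q => ?_) hf
    rw [hL]
    exact (hd q).hasFDerivAt
  exact ⟨e.symm, e.symm_apply_apply, e.apply_symm_apply, hsymm⟩

variable {n : ℕ}

/-- The partial gradient of `F` in the first `ℝⁿ` factor. -/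
noncomputable def gradX (F : H n → ℝ) (q : H n) : EuclideanSpace ℝ (Fin n) :=
  WithLp.toLp 2 fun i => fderiv ℝ F q (EuclideanSpace.single i 1, 0, 0)

/-- The partial gradient of `F` in the second `ℝⁿ` factor. -/
noncomputable def gradY (F : H n → ℝ) (q : H n) : EuclideanSpace ℝ (Fin n) :=
  WithLp.toLp 2 fun i => fderiv ℝ F q (0, EuclideanSpace.single i 1, 0)

/-- The partial derivative of `F` in the last coordinate. -/
noncomputable def derivZ (F : H n → ℝ) (q : H n) : ℝ :=
  fderiv ℝ F q (0, 0, 1)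

lemma EuclideanSpace.eq_sum_smul_single (u : EuclideanSpace ℝ (Fin n)) :
    u = ∑ i, u i • EuclideanSpace.single i (1 : ℝ) := by
  ext j
  simp [Pi.single_apply]

lemma fderiv_apply_fst (F : H n → ℝ) (q : H n) (u : EuclideanSpace ℝ (Fin n)) :
    fderiv ℝ F q (u, 0, 0) = ∑ i, gradX F q i * u i := by
  have h := congrArg ((fderiv ℝ F q).comp (ContinuousLinearMap.inl ℝ _ _))
    (EuclideanSpace.eq_sum_smul_single u)
  simp only [map_sum, map_smul] at h
  exact h.trans (Finset.sum_congr rfl fun i _ => mul_comm _ _)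

lemma fderiv_apply_snd (F : H n → ℝ) (q : H n) (u : EuclideanSpace ℝ (Fin n)) :
    fderiv ℝ F q (0, u, 0) = ∑ i, gradY F q i * u i := by
  have h := congrArg ((fderiv ℝ F q).comp
    ((ContinuousLinearMap.inr ℝ _ _).comp (ContinuousLinearMap.inl ℝ _ _)))
    (EuclideanSpace.eq_sum_smul_single u)
  simp only [map_sum, map_smul] at h
  exact h.trans (Finset.sum_congr rfl fun i _ => mul_comm _ _)

lemma fderiv_eq_grad (F : H n → ℝ) (q η : H n) :
    fderiv ℝ F q η =
      ∑ i, gradX F q i * η.1 i + ∑ i, gradY F q i * η.2.1 i + derivZ F q * η.2.2 := by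
  have h : η = (η.1, 0, 0) + (0, η.2.1, 0) + η.2.2 • ((0, 0, 1) : H n) := by
    ext <;> simp
  conv_lhs => rw [h]
  rw [map_add, map_add, map_smul, fderiv_apply_fst, fderiv_apply_snd, derivZ, smul_eq_mul,
    mul_comm η.2.2]

lemma contDiff_fderiv_apply_const {F : H n → ℝ} (hF : ContDiff ℝ ∞ F) (v : H n) :
    ContDiff ℝ ∞ fun q => fderiv ℝ F q v :=
  (hF.fderiv_right (m := ∞) (by simp)).clm_apply contDiff_const

lemma contDiff_gradX {F : H n → ℝ} (hF : ContDiff ℝ ∞ F) : ContDiff ℝ ∞ (gradX F) :=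
  contDiff_euclidean.2 fun _ => contDiff_fderiv_apply_const hF _

lemma contDiff_gradY {F : H n → ℝ} (hF : ContDiff ℝ ∞ F) : ContDiff ℝ ∞ (gradY F) :=
  contDiff_euclidean.2 fun _ => contDiff_fderiv_apply_const hF _

lemma contDiff_derivZ {F : H n → ℝ} (hF : ContDiff ℝ ∞ F) : ContDiff ℝ ∞ (derivZ F) :=
  contDiff_fderiv_apply_const hF _

lemma gradX_const_smul (ε : ℝ) (F : H n → ℝ) (q : H n) : gradX (ε • F) q = ε • gradX F q := by
  ext i
  simp [gradX, fderiv_const_smul_field]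

lemma gradY_const_smul (ε : ℝ) (F : H n → ℝ) (q : H n) : gradY (ε • F) q = ε • gradY F q := by
  ext i
  simp [gradY, fderiv_const_smul_field]

lemma derivZ_const_smul (ε : ℝ) (F : H n → ℝ) (q : H n) : derivZ (ε • F) q = ε * derivZ F q := by
  simp [derivZ, fderiv_const_smul_field]

/-- The source map of the generating function `F`: if `q = (x, Y, z)`, this is the point
`(x, y, z)` which the contactomorphism generated by `F` moves to `genTarget F q`. -/
noncomputable def genSource (F : H n → ℝ) (q : H n) : H n :=
  (q.1, (1 + derivZ F q)⁻¹ • (q.2.1 - gradX F q), q.2.2)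

/-- The target map of the generating function `F`: if `q = (x, Y, z)`, this is the point
`(x - ∂F/∂Y, Y, z + F - ⟨Y, ∂F/∂Y⟩)`. -/
noncomputable def genTarget (F : H n → ℝ) (q : H n) : H n :=
  (q.1 - gradY F q, q.2.1, q.2.2 + F q - ∑ i, q.2.1 i * gradY F q i)

lemma contDiff_genSource {F : H n → ℝ} (hF : ContDiff ℝ ∞ F) (h : ∀ q, 1 + derivZ F q ≠ 0) :
    ContDiff ℝ ∞ (genSource F) := by
  refine contDiff_fst.prodMk (ContDiff.prodMk ?_ (contDiff_snd.comp contDiff_snd))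
  exact ((contDiff_const.add (contDiff_derivZ hF)).inv h).smul
    ((contDiff_fst.comp contDiff_snd).sub (contDiff_gradX hF))

lemma contDiff_sum_coord_mul {u v : H n → EuclideanSpace ℝ (Fin n)} (hu : ContDiff ℝ ∞ u)
    (hv : ContDiff ℝ ∞ v) : ContDiff ℝ ∞ fun q => ∑ i, u q i * v q i :=
  ContDiff.sum fun i _ => (contDiff_euclidean.1 hu i).mul (contDiff_euclidean.1 hv i)

lemma contDiff_genTarget {F : H n → ℝ} (hF : ContDiff ℝ ∞ F) : ContDiff ℝ ∞ (genTarget F) := by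
  refine (contDiff_fst.sub (contDiff_gradY hF)).prodMk
    ((contDiff_fst.comp contDiff_snd).prodMk (ContDiff.sub ?_ ?_))
  · exact (contDiff_snd.comp contDiff_snd).add hF
  · exact contDiff_sum_coord_mul (contDiff_fst.comp contDiff_snd) (contDiff_gradY hF)

lemma fderiv_fst_comp {f : H n → H n} {q : H n} (hf : DifferentiableAt ℝ f q) (η : H n) :
    (fderiv ℝ f q η).1 = fderiv ℝ (fun p => (f p).1) q η := by
  rw [fderiv.fst hf]; rfl

lemma fderiv_snd_snd_comp {f : H n → H n} {q : H n} (hf : DifferentiableAt ℝ f q) (η : H n) :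
    (fderiv ℝ f q η).2.2 = fderiv ℝ (fun p => (f p).2.2) q η := by
  rw [fderiv.snd hf.snd, fderiv.snd hf]; rfl

/-- The pullbacks of the contact form under the two maps of a generating function are
proportional. -/
lemma alpha0_fderiv_genTarget {F : H n → ℝ} (hF : ContDiff ℝ ∞ F)
    (h : ∀ q, 1 + derivZ F q ≠ 0) (q η : H n) :
    alpha0 (genTarget F q) (fderiv ℝ (genTarget F) q η) =
      (1 + derivZ F q) * alpha0 (genSource F q) (fderiv ℝ (genSource F) q η) := by
  have hS := (contDiff_genSource hF h).differentiable (by simp) q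
  have hT := (contDiff_genTarget hF).differentiable (by simp) q
  have hY : DifferentiableAt ℝ (gradY F) q := (contDiff_gradY hF).differentiable (by simp) q
  have hFd : DifferentiableAt ℝ F q := hF.differentiable (by simp) q
  have hS1 : (fderiv ℝ (genSource F) q η).1 = η.1 := by
    rw [fderiv_fst_comp hS]
    exact congrArg (· η) (fderiv_fst (𝕜 := ℝ) (p := q))
  have hS2 : (fderiv ℝ (genSource F) q η).2.2 = η.2.2 := by
    rw [fderiv_snd_snd_comp hS]
    exact congrArg (· η) (hasFDerivAt_snd.comp q (hasFDerivAt_snd (𝕜 := ℝ) (p := q))).fderiv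
  have hT1 : (fderiv ℝ (genTarget F) q η).1 = η.1 - fderiv ℝ (gradY F) q η := by
    rw [fderiv_fst_comp hT]
    exact congrArg (· η) ((hasFDerivAt_fst (𝕜 := ℝ) (p := q)).sub hY.hasFDerivAt).fderiv
  let P : Fin n → H n →L[ℝ] ℝ := fun i => (EuclideanSpace.proj i).comp
    ((ContinuousLinearMap.fst ℝ _ _).comp (ContinuousLinearMap.snd ℝ _ _))
  have hc : ∀ i, HasFDerivAt (fun p : H n => p.2.1 i * gradY F p i)
      (q.2.1 i • ((EuclideanSpace.proj i).comp (fderiv ℝ (gradY F) q)) + gradY F q i • P i) q := by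
    intro i
    have h1 : HasFDerivAt (fun p : H n => p.2.1 i) (P i) q := (P i).hasFDerivAt
    have h2 : HasFDerivAt (fun p : H n => gradY F p i)
        ((EuclideanSpace.proj i).comp (fderiv ℝ (gradY F) q)) q :=
      (EuclideanSpace.proj i : EuclideanSpace ℝ (Fin n) →L[ℝ] ℝ).hasFDerivAt.comp q
        hY.hasFDerivAt
    exact h1.mul h2
  have hT2 : (fderiv ℝ (genTarget F) q η).2.2 = η.2.2 + fderiv ℝ F q η -
      ∑ i, (q.2.1 i * fderiv ℝ (gradY F) q η i + gradY F q i * η.2.1 i) := by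
    rw [fderiv_snd_snd_comp hT]
    have hd := ((hasFDerivAt_snd.comp q (hasFDerivAt_snd (𝕜 := ℝ) (p := q))).add
      hFd.hasFDerivAt).sub (HasFDerivAt.fun_sum (u := Finset.univ) fun i _ => hc i)
    refine (congrArg (· η) hd.fderiv).trans ?_
    simp [P]
  simp only [alpha0, hS1, hS2, hT1, hT2, fderiv_eq_grad F q η]
  have hq : ∀ i, (1 + derivZ F q) * ((genSource F q).2.1 i) = q.2.1 i - gradX F q i := by
    intro i
    simp [genSource, mul_inv_cancel_left₀ (h q)]
  have hsum : (1 + derivZ F q) * ∑ i, (genSource F q).2.1 i * η.1 i =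
      ∑ i, q.2.1 i * η.1 i - ∑ i, gradX F q i * η.1 i := by
    rw [Finset.mul_sum, ← Finset.sum_sub_distrib]
    refine Finset.sum_congr rfl fun i _ => ?_
    rw [← mul_assoc, hq, sub_mul]
  rw [mul_sub, hsum]
  simp only [genTarget, PiLp.sub_apply, mul_sub, Finset.sum_sub_distrib, Finset.sum_add_distrib]
  ring

/-- Two diffeomorphisms which pull the contact form back to proportional forms, and which agree
with the identity off a compact set, differ by a compactly supported contactomorphism. -/
lemma exists_contactomorphism_comp {A A' B B' : H n → H n} {K : Set (H n)} {m : H n → ℝ}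
    (hA : ContDiff ℝ ∞ A) (hA' : ContDiff ℝ ∞ A') (hB : ContDiff ℝ ∞ B) (hB' : ContDiff ℝ ∞ B')
    (hAl : Function.LeftInverse A' A) (hAr : Function.RightInverse A' A)
    (hBl : Function.LeftInverse B' B) (hBr : Function.RightInverse B' B)
    (hK : IsCompact K) (hAK : ∀ p ∉ K, A p = p) (hBK : ∀ p ∉ K, B p = p)
    (hm : ∀ q η, alpha0 (B q) (fderiv ℝ B q η) = m q * alpha0 (A q) (fderiv ℝ A q η)) :
    ∃ φ : CSContactomorphism n, (∀ q, φ.toFun (A q) = B q) ∧ ∀ p ∉ K, φ.toFun p = p := by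
  have hsupp : ∀ p ∉ K, B (A' p) = p := fun p hp => by
    have h : A' p = p := by
      conv_lhs => rw [← hAK p hp]
      exact hAl p
    rw [h, hBK p hp]
  refine ⟨{ toFun := fun p => B (A' p)
            invFun := fun p => A (B' p)
            left_inv := fun p => (congrArg A (hBl _)).trans (hAr p)
            right_inv := fun p => (congrArg B (hAl _)).trans (hBr p)
            smooth := hB.comp hA'
            smooth_inv := hA.comp hB'
            compactSupp := ?_
            contact := ?_ }, fun q => by simp only [hAl q], hsupp⟩
  · refine hK.of_isClosed_subset isClosed_closure (closure_minimal ?_ hK.isClosed)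
    intro p hp
    by_contra h
    exact hp (hsupp p h)
  · intro p ζ hζ
    have hdA : ∀ q, DifferentiableAt ℝ A q := hA.differentiable (by simp)
    have hdA' : ∀ q, DifferentiableAt ℝ A' q := hA'.differentiable (by simp)
    have hdB : ∀ q, DifferentiableAt ℝ B q := hB.differentiable (by simp)
    have hcomp : fderiv ℝ A (A' p) (fderiv ℝ A' p ζ) = ζ := by
      have h := fderiv_comp p (hdA (A' p)) (hdA' p)
      rw [hAr.comp_eq_id, fderiv_id] at h
      exact (congrArg (· ζ) h).symm
    have h := hm (A' p) (fderiv ℝ A' p ζ)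
    rw [hcomp, hAr p, hζ, mul_zero] at h
    have hBA : fderiv ℝ (fun p => B (A' p)) p = (fderiv ℝ B (A' p)).comp (fderiv ℝ A' p) :=
      fderiv_comp p (hdB (A' p)) (hdA' p)
    rw [hBA]
    exact h

lemma exists_bound_of_hasCompactSupport {W : Type*} [NormedAddCommGroup W] [NormedSpace ℝ W]
    {G : H n → W} (hG : ContDiff ℝ ∞ G) (hc : HasCompactSupport G) :
    ∃ C : ℝ, 0 ≤ C ∧ ∀ q, ‖G q‖ ≤ C ∧ ‖fderiv ℝ G q‖ ≤ C := by
  obtain ⟨C₁, h₁⟩ := hc.exists_bound_of_continuous hG.continuous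
  obtain ⟨C₂, h₂⟩ := (hc.fderiv (𝕜 := ℝ)).exists_bound_of_continuous
    (hG.continuous_fderiv (by simp))
  exact ⟨max C₁ C₂, (norm_nonneg _).trans ((h₁ 0).trans (le_max_left _ _)),
    fun q => ⟨(h₁ q).trans (le_max_left _ _), (h₂ q).trans (le_max_right _ _)⟩⟩

lemma norm_fderiv_smul_le {W : Type*} [NormedAddCommGroup W] [NormedSpace ℝ W]
    {D : H n → ℝ} {N : H n → W} {q : H n} (hD : DifferentiableAt ℝ D q)
    (hN : DifferentiableAt ℝ N q) {C ε : ℝ} (hDq : ‖D q‖ ≤ C) (hD' : ‖fderiv ℝ D q‖ ≤ C)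
    (hNq : ‖N q‖ ≤ C) (hN' : ‖fderiv ℝ N q‖ ≤ C) (hε : |ε| * C ≤ 1 / 8) :
    ‖fderiv ℝ (fun p => (ε * (1 + ε * D p)⁻¹) • N p) q‖ ≤ 1 / 2 := by
  have hC : 0 ≤ C := (norm_nonneg _).trans hDq
  have hεD : |ε * D q| ≤ 1 / 8 := by
    rw [abs_mul]
    exact (mul_le_mul_of_nonneg_left hDq (abs_nonneg _)).trans hε
  have hpos : 1 / 2 ≤ 1 + ε * D q := by linarith [(abs_le.1 hεD).1]
  have hinv : |(1 + ε * D q)⁻¹| ≤ 2 := by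
    rw [abs_inv, abs_of_nonneg (by linarith)]
    exact inv_le_of_inv_le₀ (by norm_num) (by linarith)
  have hder : HasFDerivAt (fun p => ε * (1 + ε * D p)⁻¹)
      (ε • (-((1 + ε * D q) ^ 2)⁻¹ • (ε • fderiv ℝ D q))) q :=
    ((hasDerivAt_inv (by linarith : (1 + ε * D q) ≠ 0)).comp_hasFDerivAt q
      ((hD.hasFDerivAt.const_mul ε).const_add 1)).const_mul ε
  rw [(hder.fun_smul hN.hasFDerivAt).fderiv]
  refine (norm_add_le _ _).trans ?_
  have h1 : ‖(ε * (1 + ε * D q)⁻¹) • fderiv ℝ N q‖ ≤ 1 / 4 := by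
    rw [norm_smul, Real.norm_eq_abs, abs_mul]
    calc |ε| * |(1 + ε * D q)⁻¹| * ‖fderiv ℝ N q‖ ≤ |ε| * 2 * C := by gcongr
      _ ≤ 1 / 4 := by linarith
  have h2 : ‖ε • (-((1 + ε * D q) ^ 2)⁻¹ • (ε • fderiv ℝ D q))‖ ≤ |ε| * (4 * (|ε| * C)) := by
    rw [norm_smul, norm_smul, norm_smul, Real.norm_eq_abs, Real.norm_eq_abs, abs_neg, ← inv_pow,
      abs_pow]
    have : |(1 + ε * D q)⁻¹| ^ 2 ≤ 4 := by
      nlinarith [abs_nonneg ((1 + ε * D q)⁻¹)]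
    gcongr
  rw [ContinuousLinearMap.norm_smulRight_apply]
  have h3 : |ε| * (4 * (|ε| * C)) * C ≤ 1 / 4 := by
    have : 0 ≤ |ε| * C := by positivity
    nlinarith
  have h4 := mul_le_mul h2 hNq (norm_nonneg _) (by positivity)
  linarith

lemma gradX_eq_zero {F : H n → ℝ} {q : H n} (h : fderiv ℝ F q = 0) : gradX F q = 0 := by
  ext i; simp [gradX, h]

lemma gradY_eq_zero {F : H n → ℝ} {q : H n} (h : fderiv ℝ F q = 0) : gradY F q = 0 := by
  ext i; simp [gradY, h]

lemma derivZ_eq_zero {F : H n → ℝ} {q : H n} (h : fderiv ℝ F q = 0) : derivZ F q = 0 := by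
  simp [derivZ, h]

lemma genSource_eq_self {F : H n → ℝ} {q : H n} (h : fderiv ℝ F q = 0) : genSource F q = q := by
  simp [genSource, gradX_eq_zero h, derivZ_eq_zero h]

lemma genTarget_eq_of_fderiv_eq_zero {F : H n → ℝ} {q : H n} (h : fderiv ℝ F q = 0) :
    genTarget F q = (q.1, q.2.1, q.2.2 + F q) := by
  simp [genTarget, gradY_eq_zero h]

/-- Small multiples of a compactly supported function generate contactomorphisms. -/
theorem exists_contactomorphism_of_generating {F : H n → ℝ} (hF : ContDiff ℝ ∞ F)
    (hc : HasCompactSupport F) :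
    ∃ ε₀ > 0, ∀ ε : ℝ, |ε| < ε₀ →
      (∃ φ : CSContactomorphism n,
        (∀ q, φ.toFun (genSource (ε • F) q) = genTarget (ε • F) q) ∧
          ∀ p ∉ tsupport F, φ.toFun p = p) ∧
      (∃ φ : CSContactomorphism n,
        ∀ q, φ.toFun (genTarget (ε • F) q) = genSource (ε • F) q) ∧
      Function.Surjective (genSource (ε • F)) := by
  let N : H n → H n := fun q => (0, gradX F q + derivZ F q • q.2.1, 0)
  let M : H n → H n := fun q => (-gradY F q, 0, F q - ∑ i, q.2.1 i * gradY F q i)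
  have hN : ContDiff ℝ ∞ N := contDiff_const.prodMk (ContDiff.prodMk
    ((contDiff_gradX hF).add ((contDiff_derivZ hF).smul (contDiff_fst.comp contDiff_snd)))
    contDiff_const)
  have hM : ContDiff ℝ ∞ M := (contDiff_gradY hF).neg.prodMk (contDiff_const.prodMk
    (hF.sub (contDiff_sum_coord_mul (contDiff_fst.comp contDiff_snd) (contDiff_gradY hF))))
  have hD := contDiff_derivZ hF
  have hz : ∀ q ∉ tsupport F, fderiv ℝ F q = 0 := fun q hq => fderiv_of_notMem_tsupport ℝ hq
  have hNc : HasCompactSupport N := HasCompactSupport.intro hc fun q hq => by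
    simp [N, gradX_eq_zero (hz q hq), derivZ_eq_zero (hz q hq)]
  have hMc : HasCompactSupport M := HasCompactSupport.intro hc fun q hq => by
    simp [M, gradY_eq_zero (hz q hq), image_eq_zero_of_notMem_tsupport hq]
  have hDc : HasCompactSupport (derivZ F) := HasCompactSupport.intro hc fun q hq =>
    derivZ_eq_zero (hz q hq)
  obtain ⟨C₁, hC₁, h₁⟩ := exists_bound_of_hasCompactSupport hN hNc
  obtain ⟨C₂, hC₂, h₂⟩ := exists_bound_of_hasCompactSupport hM hMc
  obtain ⟨C₃, hC₃, h₃⟩ := exists_bound_of_hasCompactSupport hD hDc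
  set C := C₁ + C₂ + C₃ + 1 with hC
  have hCpos : 0 < C := by positivity
  refine ⟨1 / (8 * C), by positivity, fun ε hε => ?_⟩
  have hεC : |ε| * C ≤ 1 / 8 := by
    rw [lt_div_iff₀ (by positivity)] at hε
    linarith
  have hne : ∀ q, 1 + derivZ (ε • F) q ≠ 0 := fun q => by
    rw [derivZ_const_smul]
    have : |ε * derivZ F q| ≤ 1 / 8 := by
      rw [abs_mul]
      refine (mul_le_mul_of_nonneg_left ((h₃ q).1.trans ?_) (abs_nonneg _)).trans hεC
      linarith
    linarith [(abs_le.1 this).1]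
  have hεF : ContDiff ℝ ∞ (ε • F) := contDiff_const.smul hF
  have hS := contDiff_genSource hεF hne
  have hT := contDiff_genTarget hεF
  have hSeq : genSource (ε • F) = fun q => q - (ε * (1 + ε * derivZ F q)⁻¹) • N q := by
    ext1 q
    have h := hne q
    rw [derivZ_const_smul] at h
    refine Prod.ext (by simp [genSource, N]) (Prod.ext ?_ (by simp [genSource, N]))
    ext i
    simp only [genSource, N, derivZ_const_smul, gradX_const_smul, PiLp.smul_apply, PiLp.sub_apply,
      PiLp.add_apply, Prod.snd_sub, Prod.fst_sub, Prod.smul_snd, Prod.smul_fst, smul_eq_mul]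
    field_simp
    ring
  have hTeq : genTarget (ε • F) = fun q => q + ε • M q := by
    ext1 q
    refine Prod.ext (by simp [genTarget, M, gradY_const_smul, sub_eq_add_neg])
      (Prod.ext (by simp [genTarget, M]) ?_)
    simp only [genTarget, M, gradY_const_smul, Prod.snd_add, Prod.smul_snd, PiLp.smul_apply,
      smul_eq_mul, Pi.smul_apply, mul_sub, Finset.mul_sum, mul_left_comm]
    ring
  have hSd : ∀ q, ‖fderiv ℝ (genSource (ε • F)) q - ContinuousLinearMap.id ℝ (H n)‖ ≤ 1 / 2 := by
    intro q
    have hdS : DifferentiableAt ℝ (genSource (ε • F)) q := hS.differentiable (by simp) q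
    have hle := norm_fderiv_smul_le (hD.differentiable (by simp) q)
      (hN.differentiable (by simp) q) (C := C) ((h₃ q).1.trans (by linarith))
      ((h₃ q).2.trans (by linarith)) ((h₁ q).1.trans (by linarith))
      ((h₁ q).2.trans (by linarith)) hεC
    have heq : (fun p => (ε * (1 + ε * derivZ F p)⁻¹) • N p) =
        fun p => p - genSource (ε • F) p := by
      rw [hSeq]
      ext1 p
      exact (sub_sub_cancel _ _).symm
    rw [heq, fderiv_fun_sub differentiableAt_fun_id hdS, fderiv_fun_id, norm_sub_rev] at hle
    exact hle
  have hTd : ∀ q, ‖fderiv ℝ (genTarget (ε • F)) q - ContinuousLinearMap.id ℝ (H n)‖ ≤ 1 / 2 := by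
    intro q
    have hdM : DifferentiableAt ℝ M q := hM.differentiable (by simp) q
    rw [hTeq, fderiv_fun_add differentiableAt_fun_id (hdM.fun_const_smul ε), fderiv_fun_id,
      add_sub_cancel_left, fderiv_fun_const_smul hdM, norm_smul, Real.norm_eq_abs]
    have := mul_le_mul_of_nonneg_left ((h₂ q).2.trans (by linarith : C₂ ≤ C)) (abs_nonneg ε)
    linarith
  obtain ⟨A', hAl, hAr, hA'⟩ := exists_smooth_inverse hS hSd
  obtain ⟨B', hBl, hBr, hB'⟩ := exists_smooth_inverse hT hTd
  have hzε : ∀ q ∉ tsupport F, fderiv ℝ (ε • F) q = 0 := fun q hq => by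
    rw [fderiv_const_smul_field, Pi.smul_apply, hz q hq, smul_zero]
  have hSK : ∀ q ∉ tsupport F, genSource (ε • F) q = q := fun q hq => genSource_eq_self (hzε q hq)
  have hTK : ∀ q ∉ tsupport F, genTarget (ε • F) q = q := fun q hq => by
    rw [genTarget_eq_of_fderiv_eq_zero (hzε q hq)]
    simp [image_eq_zero_of_notMem_tsupport hq]
  refine ⟨?_, ?_, hAr.surjective⟩
  · exact exists_contactomorphism_comp hS hA' hT hB' hAl hAr hBl hBr hc hSK hTK
      (alpha0_fderiv_genTarget hεF hne)
  · obtain ⟨φ, hφ, -⟩ := exists_contactomorphism_comp (m := fun q => (1 + derivZ (ε • F) q)⁻¹)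
      hT hB' hS hA' hBl hBr hAl hAr hc hTK hSK fun q η => by
        rw [alpha0_fderiv_genTarget hεF hne, inv_mul_cancel_left₀ (hne q)]
    exact ⟨φ, hφ⟩

/-- A rotationally symmetric bump function centred at `p`. -/
noncomputable def radialBump (p : H n) (r : ℝ) (q : H n) : ℝ :=
  expNegInvGlue (r ^ 2 - ‖q.1 - p.1‖ ^ 2 - ‖q.2.1 - p.2.1‖ ^ 2 - (q.2.2 - p.2.2) ^ 2)

lemma contDiff_radialBump (p : H n) (r : ℝ) : ContDiff ℝ ∞ (radialBump p r) := by
  refine (expNegInvGlue.contDiff (n := ⊤)).comp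
    (ContDiff.sub (ContDiff.sub (contDiff_const.sub ?_) ?_) ?_)
  · exact (contDiff_fst.sub contDiff_const).norm_sq ℝ
  · exact ((contDiff_fst.comp contDiff_snd).sub contDiff_const).norm_sq ℝ
  · exact ((contDiff_snd.comp contDiff_snd).sub contDiff_const).pow 2

lemma tsupport_radialBump_subset (p : H n) {r : ℝ} (hr : 0 ≤ r) :
    tsupport (radialBump p r) ⊆ Metric.closedBall p r := by
  refine closure_minimal (fun q hq => ?_) Metric.isClosed_closedBall
  have h : 0 < r ^ 2 - ‖q.1 - p.1‖ ^ 2 - ‖q.2.1 - p.2.1‖ ^ 2 - (q.2.2 - p.2.2) ^ 2 := by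
    by_contra h
    exact hq (expNegInvGlue.zero_of_nonpos (not_lt.1 h))
  have h1 := sq_nonneg ‖q.1 - p.1‖
  have h2 := sq_nonneg ‖q.2.1 - p.2.1‖
  have h3 := sq_nonneg (q.2.2 - p.2.2)
  rw [mem_closedBall_iff_norm, Prod.norm_def, Prod.norm_def]
  refine max_le (abs_le_of_sq_le_sq' (by linarith!) hr).2
    (max_le (abs_le_of_sq_le_sq' (by linarith!) hr).2 (abs_le_of_sq_le_sq (by simp only [Prod.snd_sub]; linarith) hr))

lemma radialBump_nonneg (p : H n) (r : ℝ) (q : H n) : 0 ≤ radialBump p r q :=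
  expNegInvGlue.nonneg _

lemma radialBump_self_pos (p : H n) {r : ℝ} (hr : 0 < r) : 0 < radialBump p r p := by
  apply expNegInvGlue.pos_of_pos
  simpa using pow_pos hr 2

lemma fderiv_radialBump_self (p : H n) (r : ℝ) : fderiv ℝ (radialBump p r) p = 0 := by
  refine IsLocalMax.fderiv_eq_zero (Filter.Eventually.of_forall fun q => ?_)
  apply expNegInvGlue.monotone
  simp only [sub_self, norm_zero]
  nlinarith [sq_nonneg ‖q.1 - p.1‖, sq_nonneg ‖q.2.1 - p.2.1‖, sq_nonneg (q.2.2 - p.2.2)]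

lemma sum_gradY_radialBump_nonpos (p : H n) (r : ℝ) (q : H n) :
    ∑ i, gradY (radialBump p r) q i * (q.2.1 - p.2.1) i ≤ 0 := by
  rw [← fderiv_apply_snd]
  set v : H n := (0, q.2.1 - p.2.1, 0) with hv
  have hline : HasDerivAt (fun t : ℝ => radialBump p r (q + t • v))
      (fderiv ℝ (radialBump p r) q v) 0 :=
    ((contDiff_radialBump p r).differentiable (by simp) q).hasFDerivAt.hasLineDerivAt v
  set B := ‖q.2.1 - p.2.1‖ ^ 2 with hB
  have hfun : (fun t : ℝ => radialBump p r (q + t • v)) = fun t : ℝ => expNegInvGlue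
      (r ^ 2 - ‖q.1 - p.1‖ ^ 2 - (1 + t) ^ 2 * B - (q.2.2 - p.2.2) ^ 2) := by
    ext t
    have h : q.2.1 + t • (q.2.1 - p.2.1) - p.2.1 = (1 + t) • (q.2.1 - p.2.1) := by module
    simp [radialBump, hv, h, norm_smul, mul_pow, hB]
  have hin : HasDerivAt (fun t : ℝ => r ^ 2 - ‖q.1 - p.1‖ ^ 2 - (1 + t) ^ 2 * B -
      (q.2.2 - p.2.2) ^ 2) (-(2 * B)) 0 := by
    have := ((((((hasDerivAt_id (0 : ℝ)).const_add 1).pow 2).mul_const B).const_sub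
      (r ^ 2 - ‖q.1 - p.1‖ ^ 2)).sub_const ((q.2.2 - p.2.2) ^ 2))
    simpa using this
  have hg := ((expNegInvGlue.contDiff (n := 1)).differentiable (by simp)
    (r ^ 2 - ‖q.1 - p.1‖ ^ 2 - (1 + 0) ^ 2 * B - (q.2.2 - p.2.2) ^ 2)).hasDerivAt
  rw [hfun] at hline
  rw [hline.unique (HasDerivAt.comp (0 : ℝ) (h₂ := expNegInvGlue) hg hin)]
  have h0 : 0 ≤ deriv expNegInvGlue
      (r ^ 2 - ‖q.1 - p.1‖ ^ 2 - (1 + 0) ^ 2 * B - (q.2.2 - p.2.2) ^ 2) :=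
    expNegInvGlue.monotone.deriv_nonneg
  have : 0 ≤ B := sq_nonneg _
  nlinarith

/-- Every point can be moved by a contactomorphism supported nearby which nowhere decreases a
suitable linear function and strictly increases it at the given point. -/
theorem exists_contactomorphism_increasing {U : Set (H n)} (hU : IsOpen U) {p : H n}
    (hp : p ∈ U) :
    ∃ (φ : CSContactomorphism n) (L : H n → ℝ) (K : Set (H n)), Continuous L ∧ IsClosed K ∧
      K ⊆ U ∧ (∀ q ∉ K, φ.toFun q = q) ∧ (∀ q, L q ≤ L (φ.toFun q)) ∧ L p < L (φ.toFun p) := by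
  obtain ⟨r, hr, hrU⟩ := Metric.nhds_basis_closedBall.mem_iff.1 (hU.mem_nhds hp)
  set F := radialBump p r with hF
  have hsub := tsupport_radialBump_subset p hr.le
  have hFc : HasCompactSupport F :=
    (isCompact_closedBall p r).of_isClosed_subset (isClosed_tsupport _) hsub
  obtain ⟨ε₀, hε₀, h⟩ := exists_contactomorphism_of_generating (contDiff_radialBump p r) hFc
  have hε : |ε₀ / 2| < ε₀ := by rw [abs_of_pos (half_pos hε₀)]; exact half_lt_self hε₀
  obtain ⟨⟨φ, hφ, hφK⟩, -, hsurj⟩ := h (ε₀ / 2) hε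
  set ε := ε₀ / 2
  have hεpos : 0 < ε := half_pos hε₀
  let L : H n → ℝ := fun q => q.2.2 - ∑ i, p.2.1 i * q.1 i
  have hL : ∀ q, L (genTarget (ε • F) q) = L (genSource (ε • F) q) +
      ε * (F q - ∑ i, gradY F q i * (q.2.1 - p.2.1) i) := by
    intro q
    simp only [L, genTarget, genSource, gradY_const_smul, PiLp.smul_apply, PiLp.sub_apply,
      smul_eq_mul, Pi.smul_apply, mul_sub, Finset.sum_sub_distrib, Finset.mul_sum]
    have h1 : ∀ i, q.2.1 i * (ε * gradY F q i) = ε * (gradY F q i * q.2.1 i) := fun i => by ring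
    have h2 : ∀ i, p.2.1 i * (ε * gradY F q i) = ε * (gradY F q i * p.2.1 i) := fun i => by ring
    simp only [h1, h2]
    ring
  refine ⟨φ, L, tsupport F, by fun_prop, isClosed_tsupport F, hsub.trans hrU, hφK, fun q => ?_, ?_⟩
  · obtain ⟨w, rfl⟩ := hsurj q
    rw [hφ, hL]
    have h1 := sum_gradY_radialBump_nonpos p r w
    have h2 := radialBump_nonneg p r w
    have : 0 ≤ ε * (F w - ∑ i, gradY F w i * (w.2.1 - p.2.1) i) :=
      mul_nonneg hεpos.le (by linarith)
    linarith
  · have hd : fderiv ℝ (ε • F) p = 0 := by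
      rw [fderiv_const_smul_field, Pi.smul_apply, fderiv_radialBump_self, smul_zero]
    have h1 := hL p
    rw [← hφ, genSource_eq_self hd] at h1
    have h2 := mul_pos hεpos (radialBump_self_pos p hr)
    rw [h1]
    simpa using h2

/-- A point can be moved in every direction: contactomorphisms realise all small displacements
of the form prescribed by an affine generating function. -/
lemma exists_contactomorphism_displacement (w : H n) (u v : EuclideanSpace ℝ (Fin n)) (c : ℝ) :
    ∃ ε₀ > 0, ∀ ε : ℝ, |ε| < ε₀ →
      (∃ φ : CSContactomorphism n, φ.toFun (w + ε • ((0, -u, 0) : H n)) =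
        w + ε • ((-v, 0, c - ∑ i, w.2.1 i * v i) : H n)) ∧
      (∃ φ : CSContactomorphism n,
        φ.toFun (w + ε • ((-v, 0, c - ∑ i, w.2.1 i * v i) : H n)) =
          w + ε • ((0, -u, 0) : H n)) := by
  let ℓ : H n →L[ℝ] ℝ := (innerSL ℝ u).comp (ContinuousLinearMap.fst ℝ _ _) +
    (innerSL ℝ v).comp ((ContinuousLinearMap.fst ℝ _ _).comp (ContinuousLinearMap.snd ℝ _ _))
  let χ : ContDiffBump w := ⟨1, 2, one_pos, one_lt_two⟩
  let F : H n → ℝ := fun q => χ q * (c + ℓ (q - w))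
  have hF : ContDiff ℝ ∞ F :=
    χ.contDiff.mul (contDiff_const.add (ℓ.contDiff.comp (contDiff_id.sub contDiff_const)))
  have hFc : HasCompactSupport F := χ.hasCompactSupport.mul_right
  have hFw : F w = c := by simp [F, χ.eventuallyEq_one.self_of_nhds]
  have hder : fderiv ℝ F w = ℓ := by
    have heq : F =ᶠ[𝓝 w] fun q => c + ℓ (q - w) := by
      filter_upwards [χ.eventuallyEq_one] with q hq
      simp [F, hq]
    rw [heq.fderiv_eq]
    exact ((ℓ.hasFDerivAt.comp w ((hasFDerivAt_id w).sub_const w)).const_add c).fderiv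
  have hX : gradX F w = u := by
    ext i
    simp [gradX, hder, ℓ, EuclideanSpace.inner_single_right]
  have hY : gradY F w = v := by
    ext i
    simp [gradY, hder, ℓ, EuclideanSpace.inner_single_right]
  have hZ : derivZ F w = 0 := by simp [derivZ, hder, ℓ]
  obtain ⟨ε₀, hε₀, h⟩ := exists_contactomorphism_of_generating hF hFc
  refine ⟨ε₀, hε₀, fun ε hε => ?_⟩
  have hS : genSource (ε • F) w = w + ε • ((0, -u, 0) : H n) := by
    refine Prod.ext ?_ (Prod.ext ?_ ?_) <;>
      simp [genSource, gradX_const_smul, derivZ_const_smul, hX, hZ, sub_eq_add_neg]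
  have hT : genTarget (ε • F) w = w + ε • ((-v, 0, c - ∑ i, w.2.1 i * v i) : H n) := by
    refine Prod.ext ?_ (Prod.ext ?_ ?_)
    · simp [genTarget, gradY_const_smul, hY, sub_eq_add_neg]
    · simp [genTarget]
    · simp only [genTarget, gradY_const_smul, hY, hFw, Pi.smul_apply, smul_eq_mul, PiLp.smul_apply,
        Prod.snd_add, Prod.smul_snd, mul_sub, Finset.mul_sum, mul_left_comm]
      ring
  obtain ⟨⟨φ, hφ, -⟩, ⟨φ', hφ'⟩, -⟩ := h ε hε
  rw [← hS, ← hT]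
  exact ⟨⟨φ, hφ w⟩, ⟨φ', hφ' w⟩⟩

lemma mem_iff_add_smul_mem {E : Type*} [AddCommGroup E] [Module ℝ E] {V : Set E} {d : E}
    (h : ∀ w, ∃ ε₀ > 0, ∀ ε : ℝ, |ε| < ε₀ → (w + ε • d ∈ V ↔ w ∈ V)) (w : E) (t : ℝ) :
    w + t • d ∈ V ↔ w ∈ V := by
  have hloc : IsLocallyConstant fun s : ℝ => w + s • d ∈ V := by
    rw [IsLocallyConstant.iff_eventually_eq]
    intro s
    obtain ⟨ε₀, hε₀, hs⟩ := h (w + s • d)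
    filter_upwards [Metric.ball_mem_nhds s hε₀] with s' hs'
    have := hs (s' - s) (by simpa [Real.dist_eq] using hs')
    rw [add_assoc, ← add_smul, add_sub_cancel] at this
    exact propext this
  have := hloc.apply_eq_of_preconnectedSpace t 0
  simpa using this

/-- The group of compactly supported contactomorphisms acts transitively: an invariant set
containing a point is everything. -/
theorem mem_of_mem_of_invariant {V : Set (H n)}
    (hV : ∀ (φ : CSContactomorphism n) (p : H n), φ.toFun p ∈ V → p ∈ V) {p : H n} (hp : p ∈ V)
    (q : H n) : q ∈ V := by
  have hXZ : ∀ (v : EuclideanSpace ℝ (Fin n)) (c : ℝ) (w : H n) (t : ℝ),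
      w + t • ((v, 0, c) : H n) ∈ V ↔ w ∈ V := fun v c =>
    mem_iff_add_smul_mem fun w => by
      obtain ⟨ε₀, hε₀, h⟩ := exists_contactomorphism_displacement w 0 (-v)
        (c + ∑ i, w.2.1 i * (-v) i)
      refine ⟨ε₀, hε₀, fun ε hε => ?_⟩
      obtain ⟨⟨φ, hφ⟩, ⟨φ', hφ'⟩⟩ := h ε hε
      have h0 : ((0, -0, 0) : H n) = 0 := by simp
      rw [neg_neg, add_sub_cancel_right, h0, smul_zero, add_zero] at hφ hφ'
      exact ⟨fun hw => hV φ _ (by rwa [hφ]), fun hw => hV φ' _ (by rwa [hφ'])⟩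
  have hY : ∀ (u : EuclideanSpace ℝ (Fin n)) (w : H n) (t : ℝ),
      w + t • ((0, u, 0) : H n) ∈ V ↔ w ∈ V := fun u =>
    mem_iff_add_smul_mem fun w => by
      obtain ⟨ε₀, hε₀, h⟩ := exists_contactomorphism_displacement w (-u) 0 0
      refine ⟨ε₀, hε₀, fun ε hε => ?_⟩
      obtain ⟨⟨φ, hφ⟩, ⟨φ', hφ'⟩⟩ := h ε hε
      have h0 : ((-0, 0, 0 - ∑ i, w.2.1 i * (0 : EuclideanSpace ℝ (Fin n)) i) : H n) = 0 := by
        simp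
      rw [neg_neg, h0, smul_zero, add_zero] at hφ hφ'
      exact ⟨fun hw => hV φ' _ (by rwa [hφ']), fun hw => hV φ _ (by rwa [hφ])⟩
  have h1 := (hXZ (q.1 - p.1) (q.2.2 - p.2.2) p 1).2 hp
  have h2 := (hY (q.2.1 - p.2.1) _ 1).2 h1
  convert h2 using 1
  refine Prod.ext ?_ (Prod.ext ?_ ?_) <;> simp

instance isAddHaarMeasure_volume : (volume : Measure (H n)).IsAddHaarMeasure :=
  have : (volume : Measure (EuclideanSpace ℝ (Fin n) × ℝ)).IsAddHaarMeasure :=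
    Measure.prod.instIsAddHaarMeasure (volume : Measure (EuclideanSpace ℝ (Fin n)))
      (volume : Measure ℝ)
  Measure.prod.instIsAddHaarMeasure (volume : Measure (EuclideanSpace ℝ (Fin n)))
    (volume : Measure (EuclideanSpace ℝ (Fin n) × ℝ))

namespace CSContactomorphism

variable (φ : CSContactomorphism n)

lemma det_fderiv_invFun_ne_zero (p : H n) : (fderiv ℝ φ.invFun p).det ≠ 0 := by
  have h := fderiv_comp p (φ.smooth.differentiable (by simp) (φ.invFun p))
    (φ.smooth_inv.differentiable (by simp) p)
  rw [φ.right_inv.comp_eq_id, fderiv_id] at h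
  have hdet := congrArg ContinuousLinearMap.det h
  intro h0
  have hmul : ((fderiv ℝ φ.toFun (φ.invFun p)).comp (fderiv ℝ φ.invFun p)).det =
      (fderiv ℝ φ.toFun (φ.invFun p)).det * (fderiv ℝ φ.invFun p).det :=
    LinearMap.det_comp _ _
  rw [hmul, h0, mul_zero] at hdet
  have hid : (ContinuousLinearMap.id ℝ (H n)).det = 1 := LinearMap.det_id
  rw [hid] at hdet
  exact one_ne_zero hdet

lemma jac_pos (p : H n) : 0 < jac φ p := abs_pos.2 (φ.det_fderiv_invFun_ne_zero p)

lemma continuous_jac : Continuous (jac φ) :=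
  (ContinuousLinearMap.continuous_det.comp (φ.smooth_inv.continuous_fderiv (by simp))).abs

lemma jac_eq_one {K : Set (H n)} (hK : IsClosed K) (hφ : ∀ q ∉ K, φ.toFun q = q) {p : H n}
    (hp : p ∉ K) : jac φ p = 1 := by
  have heq : φ.invFun =ᶠ[𝓝 p] id := by
    filter_upwards [hK.isOpen_compl.mem_nhds hp] with q hq
    rw [id, ← congrArg φ.invFun (hφ q hq), φ.left_inv]
  rw [jac, heq.fderiv_eq, fderiv_id]
  have hid : (ContinuousLinearMap.id ℝ (H n)).det = 1 := LinearMap.det_id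
  rw [hid, abs_one]

lemma lintegral_jac_mul_comp_invFun (g : H n → ℝ≥0∞) :
    ∫⁻ p, ENNReal.ofReal (jac φ p) * g (φ.invFun p) = ∫⁻ p, g p := by
  have h := lintegral_image_eq_lintegral_abs_det_fderiv_mul (volume : Measure (H n))
    MeasurableSet.univ (f := φ.invFun) (f' := fderiv ℝ φ.invFun)
    (fun p _ => (φ.smooth_inv.differentiable (by simp) p).hasFDerivAt.hasFDerivWithinAt)
    φ.right_inv.injective.injOn g
  rw [Set.image_univ, φ.left_inv.surjective.range_eq, setLIntegral_univ, setLIntegral_univ] at h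
  exact h.symm

lemma enorm_PiTheta_sq (θ : ℝ) (f : H n → ℂ) (p : H n) :
    ‖PiTheta θ φ f p‖ₑ ^ 2 = ENNReal.ofReal (jac φ p) * ‖f (φ.invFun p)‖ₑ ^ 2 := by
  have hexp : ‖Complex.exp (Complex.I * θ * (Real.log (jac φ p) : ℂ))‖ = 1 := by
    have h : Complex.I * θ * (Real.log (jac φ p) : ℂ) =
        ((θ * Real.log (jac φ p) : ℝ) : ℂ) * Complex.I := by
      push_cast; ring
    rw [h, Complex.norm_exp_ofReal_mul_I]
  have hn : ‖PiTheta θ φ f p‖ = ‖f (φ.invFun p)‖ * Real.sqrt (jac φ p) := by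
    rw [PiTheta, norm_mul, norm_mul, hexp, mul_one, Complex.norm_real,
      Real.norm_of_nonneg (Real.sqrt_nonneg _)]
  rw [← ofReal_norm, ← ofReal_norm, hn, ← ENNReal.ofReal_pow (by positivity),
    ← ENNReal.ofReal_pow (by positivity), ← ENNReal.ofReal_mul (φ.jac_pos p).le, mul_pow,
    Real.sq_sqrt (φ.jac_pos p).le, mul_comm]

lemma PiTheta_eq_zero_iff (θ : ℝ) (f : H n → ℂ) (p : H n) :
    PiTheta θ φ f p = 0 ↔ f (φ.invFun p) = 0 := by
  have h : (Real.sqrt (jac φ p) : ℂ) ≠ 0 :=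
    Complex.ofReal_ne_zero.2 (Real.sqrt_ne_zero'.2 (φ.jac_pos p))
  simp [PiTheta, h, Complex.exp_ne_zero]

lemma PiTheta_eq_self (θ : ℝ) (f : H n → ℂ) {K : Set (H n)} (hK : IsClosed K)
    (hφ : ∀ q ∉ K, φ.toFun q = q) {p : H n} (hp : p ∉ K) : PiTheta θ φ f p = f p := by
  have hinv : φ.invFun p = p := by
    conv_lhs => rw [← hφ p hp]
    exact φ.left_inv p
  simp [PiTheta, φ.jac_eq_one hK hφ hp, hinv]

lemma memLp_PiTheta (θ : ℝ) (f : Lp ℂ 2 (volume : Measure (H n))) :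
    MemLp (PiTheta θ φ f) 2 (volume : Measure (H n)) := by
  refine ⟨?_, ?_⟩
  · have h1 : Measurable fun p => (f : H n → ℂ) (φ.invFun p) :=
      (Lp.stronglyMeasurable f).measurable.comp φ.smooth_inv.continuous.measurable
    have hj : Measurable (jac φ) := φ.continuous_jac.measurable
    exact ((h1.mul (Complex.measurable_ofReal.comp hj.sqrt)).mul
      (Complex.measurable_exp.comp
        ((Complex.measurable_ofReal.comp hj.log).const_mul _))).aestronglyMeasurable
  · have hf := Lp.eLpNorm_lt_top f
    rw [eLpNorm_lt_top_iff_lintegral_rpow_enorm_lt_top (by simp) (by simp)] at hf ⊢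
    simp only [ENNReal.toReal_ofNat, ENNReal.rpow_ofNat] at hf ⊢
    simp only [enorm_PiTheta_sq]
    rwa [φ.lintegral_jac_mul_comp_invFun (fun p => ‖(f : H n → ℂ) p‖ₑ ^ 2)]

/-- If `Π^θ(φ)` fixes `f` and `L ∘ φ ≥ L`, then `f` vanishes wherever the inequality is strict:
the finite measure `|f|² dλ` is `φ`-invariant. -/
lemma ae_eq_zero_of_PiTheta_eq (θ : ℝ) (f : Lp ℂ 2 (volume : Measure (H n)))
    (hfix : PiTheta θ φ f =ᵐ[volume] f) {L : H n → ℝ} (hL : Continuous L)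
    (hle : ∀ q, L q ≤ L (φ.toFun q)) :
    ∀ᵐ q : H n, L q < L (φ.toFun q) → (f : H n → ℂ) q = 0 := by
  set ρ : H n → ℝ≥0∞ := fun q => ‖(f : H n → ℂ) q‖ₑ ^ 2 with hρ
  set m : H n → ℝ≥0∞ := fun q => ENNReal.ofReal (Real.arctan (L q) + Real.pi / 2) with hm
  have hmL : Continuous m := ENNReal.continuous_ofReal.comp
    ((Real.continuous_arctan.comp hL).add continuous_const)
  have hρm : Measurable ρ := ((Lp.stronglyMeasurable f).measurable.enorm).pow_const 2
  have hρfin : ∫⁻ q, ρ q ≠ ⊤ := by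
    have hf := Lp.eLpNorm_lt_top f
    rw [eLpNorm_lt_top_iff_lintegral_rpow_enorm_lt_top (by simp) (by simp)] at hf
    simpa using hf.ne
  have hmono : ∀ q, m q ≤ m (φ.toFun q) := fun q =>
    ENNReal.ofReal_le_ofReal (by linarith [Real.arctan_mono (hle q)])
  have hinvt : ∫⁻ q, m (φ.toFun q) * ρ q = ∫⁻ q, m q * ρ q := by
    rw [← φ.lintegral_jac_mul_comp_invFun]
    refine lintegral_congr_ae ?_
    filter_upwards [hfix] with q hq
    rw [φ.right_inv, hρ]
    simp only
    rw [mul_left_comm, ← φ.enorm_PiTheta_sq θ, hq]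
  have hfin : ∫⁻ q, m q * ρ q ≠ ⊤ := by
    refine ne_top_of_le_ne_top (ENNReal.mul_ne_top (ENNReal.ofReal_ne_top (r := Real.pi)) hρfin) ?_
    rw [← lintegral_const_mul _ hρm]
    refine lintegral_mono fun q => ?_
    have := Real.arctan_lt_pi_div_two (L q)
    exact mul_le_mul_left (ENNReal.ofReal_le_ofReal (by linarith)) _
  have hae := ae_eq_of_ae_le_of_lintegral_le
    (Filter.Eventually.of_forall fun q => mul_le_mul_left (hmono q) (ρ q)) hfin
    ((hmL.comp φ.smooth.continuous).measurable.mul hρm).aemeasurable hinvt.le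
  filter_upwards [hae] with q hq hlt
  by_contra hne
  have hρ0 : ρ q ≠ 0 := by simpa [hρ] using hne
  have hρt : ρ q ≠ ⊤ := by simp [hρ]
  have hmq := (ENNReal.mul_left_inj hρ0 hρt).1 hq
  have hpos : 0 < Real.arctan (L (φ.toFun q)) + Real.pi / 2 := by
    linarith [Real.neg_pi_div_two_lt_arctan (L (φ.toFun q))]
  refine (ENNReal.ofReal_lt_ofReal_iff hpos).2 ?_ |>.ne hmq
  linarith [Real.arctan_strictMono hlt]

/-- If `Π^θ(φ) f` vanishes near `φ p`, then `f` vanishes near `p`. -/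
lemma ae_eq_zero_of_PiTheta (θ : ℝ) (f : H n → ℂ) {W : Set (H n)}
    (h : ∀ᵐ q : H n, q ∈ W → PiTheta θ φ f q = 0) :
    ∀ᵐ q : H n, q ∈ φ.toFun ⁻¹' W → f q = 0 := by
  rw [ae_iff] at h ⊢
  have himg := addHaar_image_eq_zero_of_differentiableOn_of_addHaar_eq_zero
    (volume : Measure (H n)) (f := φ.invFun)
    (φ.smooth_inv.differentiable (by simp)).differentiableOn h
  refine measure_mono_null (fun q hq => ?_) himg
  simp only [Set.mem_ofPred_eq, Classical.not_imp, Set.mem_preimage] at hq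
  refine ⟨φ.toFun q, ?_, φ.left_inv q⟩
  simp only [Set.mem_ofPred_eq, Classical.not_imp, PiTheta_eq_zero_iff, φ.left_inv q]
  exact hq

end CSContactomorphism

end

/-- If a nonzero closed subspace `H₀ ≤ L²(ℝ²ⁿ⁺¹)` is invariant under the
representation `Π^θ` of the group of compactly supported contactomorphisms, then
for every nonempty open `U` it contains a nonzero function vanishing a.e.
outside `U`. -/
theorem invariant_subspace_contains_small_support
    (n : ℕ) (hn : 1 ≤ n) (θ : ℝ)
    (H₀ : Submodule ℂ (Lp ℂ 2 (volume : Measure (H n))))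
    (hclosed : IsClosed (H₀ : Set (Lp ℂ 2 (volume : Measure (H n)))))
    (hne : H₀ ≠ ⊥)
    (hinv : ∀ φ : CSContactomorphism n, ∀ f ∈ H₀,
      ∀ g : Lp ℂ 2 (volume : Measure (H n)),
        (g : H n → ℂ) =ᵐ[volume] PiTheta θ φ (f : H n → ℂ) → g ∈ H₀)
    (U : Set (H n)) (hU : IsOpen U) (hUne : U.Nonempty) :
    ∃ f ∈ H₀, f ≠ 0 ∧ ∀ᵐ p ∂(volume : Measure (H n)), p ∉ U → (f : H n → ℂ) p = 0 := by
  have hPi : ∀ (φ : CSContactomorphism n), ∀ f ∈ H₀, (φ.memLp_PiTheta θ f).toLp _ ∈ H₀ :=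
    fun φ f hf => hinv φ f hf _ (φ.memLp_PiTheta θ f).coeFn_toLp
  let V : Set (H n) := {p | ∃ W ∈ nhds p, ∀ f ∈ H₀, ∀ᵐ q : H n, q ∈ W → (f : H n → ℂ) q = 0}
  have hV : ∀ (φ : CSContactomorphism n) (p : H n), φ.toFun p ∈ V → p ∈ V := by
    rintro φ p ⟨W, hW, h⟩
    refine ⟨φ.toFun ⁻¹' W, φ.smooth.continuous.continuousAt hW, fun f hf => ?_⟩
    refine φ.ae_eq_zero_of_PiTheta θ f ?_
    filter_upwards [h _ (hPi φ f hf), (φ.memLp_PiTheta θ f).coeFn_toLp] with q hq hq' hqW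
    rw [← hq', hq hqW]
  obtain ⟨p, hpU⟩ := hUne
  have hpV : p ∉ V := by
    intro hp
    refine hne ((Submodule.eq_bot_iff _).2 fun f hf => (Lp.eq_zero_iff_ae_eq_zero).2 ?_)
    refine measure_null_of_locally_null _ fun q _ => ?_
    obtain ⟨W, hW, h⟩ := mem_of_mem_of_invariant hV hp q
    refine ⟨W ∩ {x | ¬ (f : H n → ℂ) x = 0}, Filter.inter_mem (mem_nhdsWithin_of_mem_nhds hW)
      self_mem_nhdsWithin, ?_⟩
    have hWf := h f hf
    simp only [ae_iff, Classical.not_imp] at hWf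
    exact hWf
  obtain ⟨φ, L, K, hL, hK, hKU, hφK, hle, hlt⟩ := exists_contactomorphism_increasing hU hpU
  have hW : {q | L q < L (φ.toFun q)} ∈ nhds p :=
    (isOpen_lt hL (hL.comp φ.smooth.continuous)).mem_nhds hlt
  obtain ⟨f, hf, hfW⟩ : ∃ f ∈ H₀, ¬ ∀ᵐ q : H n, q ∈ {q | L q < L (φ.toFun q)} →
      (f : H n → ℂ) q = 0 := by
    by_contra! h
    exact hpV ⟨_, hW, h⟩
  have hcoe := (φ.memLp_PiTheta θ f).coeFn_toLp
  refine ⟨(φ.memLp_PiTheta θ f).toLp _ - f, H₀.sub_mem (hPi φ f hf) hf, fun h0 => hfW ?_, ?_⟩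
  · refine φ.ae_eq_zero_of_PiTheta_eq θ f (hcoe.symm.trans ?_) hL hle
    rw [sub_eq_zero.1 h0]
  · filter_upwards [Lp.coeFn_sub ((φ.memLp_PiTheta θ f).toLp _) f, hcoe] with q hq hq' hqU
    rw [hq, Pi.sub_apply, hq', φ.PiTheta_eq_self θ f hK hφK fun h => hqU (hKU h), sub_self]
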